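/- Let d ≥ 1, n := d(d+1)/2, τ* := n+1, let ḡ be an admissible metric, i.e. a symmetric positive-definite bilinear form on ℝ^d for which there is γ₀ > 0 with |Σ_{i≤j} ḡ_{ij} ℓ_{ij}| ≥ γ₀·(Σ_{i≤j}|ℓ_{ij}|)^{−τ*} for every nonzero integer vector ℓ ∈ ℤ^n, and fix 0 < ζ₁ < ζ₂ and r ∈ ℕ. Define Ω_j(ζ) := √(|j|_ḡ⁴ + ζ) for j ∈ ℤ^d. Then there exists τ (depending on r) with the following property: for every sufficiently small γ > 0 there exist a measurable set I_γ ⊂ (ζ₁,ζ₂) and a constant C > 0 such that the Lebesgue measure of (ζ₁,ζ₂) ∖ I_γ is at most C γ^{1/r}, and for every ζ ∈ I_γ, every N ≥ 1, every j₁,…,j_r ∈ ℤ^d with |j_l| ≤ N for all l, and every choice of signs σ_l ∈ {−1,+1}: if Σ_{l=1}^r σ_l Ω_{j_l}(ζ) ≠ 0 then |Σ_{l=1}^r σ_l Ω_{j_l}(ζ)| ≥ γ / N^{τ}. -/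

import Mathlib

open scoped BigOperators

namespace AG
abbrev Zd (d : ℕ) := Fin d → ℤ

noncomputable def enorm {d : ℕ} (j : Zd d) : ℝ := Real.sqrt (∑ i, ((j i : ℝ))^2)

/-- `|j|_g² = g(j,j)` for a quadratic form with coefficients `g`. -/
noncomputable def qform (d : ℕ) (g : Fin d → Fin d → ℝ) (j : Zd d) : ℝ :=
  ∑ i, ∑ k, g i k * (j i : ℝ) * (j k : ℝ)

/-- `τ* = d(d+1)/2 + 1`. -/
def tauStar (d : ℕ) : ℕ := d * (d + 1) / 2 + 1

/-- `g` is an admissible (γ-diophantine) metric: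
`|Σ_{i≤j} g_{ij} ℓ_{ij}| ≥ γ (Σ_{i≤j}|ℓ_{ij}|)^{−τ*}` for all nonzero `ℓ ∈ ℤ^{d(d+1)/2}`. -/
def Diophantine (d : ℕ) (g : Fin d → Fin d → ℝ) (γ : ℝ) : Prop :=
  ∀ ℓ : Fin d → Fin d → ℤ, (∃ i j, i ≤ j ∧ ℓ i j ≠ 0) →
    γ / (∑ i, ∑ j, if i ≤ j then (|ℓ i j| : ℝ) else 0) ^ tauStar d ≤
      |∑ i, ∑ j, if i ≤ j then g i j * (ℓ i j : ℝ) else 0|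

/-- The (rescaled) beam frequencies `Ω_j(ζ) = √(|j|_ḡ⁴ + ζ)`. -/
noncomputable def beamFreq (d : ℕ) (gbar : Fin d → Fin d → ℝ) (j : Zd d) (ζ : ℝ) : ℝ :=
  Real.sqrt ((qform d gbar j) ^ 2 + ζ)

lemma half_sub_abs (m : ℕ) : (1/2 : ℝ) ≤ |(1/2 : ℝ) - m| := by
  rcases Nat.eq_zero_or_pos m with h | h
  · subst h; simp
  · have h1 : (1:ℝ) ≤ m := by exact_mod_cast h
    rw [abs_of_nonpos (by linarith)]; linarith

lemma spaced_deriv (F : ℕ → ℝ → ℝ) (J : Set ℝ) (hJ : J.OrdConnected)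
    (hF : ∀ m : ℕ, ∀ x ∈ J, HasDerivAt (F m) ((1/2 - (m:ℝ)) * F (m+1) x) x)
    (s : ℝ) (hs : 0 < s) : ∀ n m : ℕ, ∀ ε : ℝ, ∀ x : ℕ → ℝ,
      (∀ i < 2^n, x i ∈ J ∧ |F m (x i)| ≤ ε) →
      (∀ i, i + 1 < 2^n → x i + s ≤ x (i+1)) →
      ∃ y ∈ J, |F (m+n) y| ≤ (4/s)^n * ε := by
  intro n
  induction n with
  | zero =>
    intro m ε x h1 _
    exact ⟨x 0, (h1 0 (by simp)).1, by simpa using (h1 0 (by simp)).2⟩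
  | succ n ih =>
    intro m ε x h1 h2
    have hp : 2^(n+1) = 2 * 2^n := by ring
    have key : ∀ i, ∃ y, i < 2^n → y ∈ J ∧ |F (m+1) y| ≤ 4/s*ε ∧ x (2*i) < y ∧ y < x (2*i+1) := by
      intro i
      by_cases hi : i < 2^n
      swap
      · exact ⟨0, fun h => absurd h hi⟩
      have a1 := h1 (2*i) (by omega)
      have a2 := h1 (2*i+1) (by omega)
      have a3 := h2 (2*i) (by omega)
      have hlt : x (2*i) < x (2*i+1) := by linarith
      have hsub : Set.Icc (x (2*i)) (x (2*i+1)) ⊆ J := hJ.out a1.1 a2.1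
      obtain ⟨y, hy, hyd⟩ := exists_hasDerivAt_eq_slope (F m) (fun x => (1/2 - (m:ℝ)) * F (m+1) x)
        hlt (fun z hz => (hF m z (hsub hz)).continuousAt.continuousWithinAt)
        (fun z hz => hF m z (hsub (Set.Ioo_subset_Icc_self hz)))
      refine ⟨y, fun _ => ⟨hsub (Set.Ioo_subset_Icc_self hy), ?_, hy.1, hy.2⟩⟩
      have hg : 0 < x (2*i+1) - x (2*i) := by linarith
      rw [eq_div_iff hg.ne'] at hyd
      have e1 := congrArg abs hyd
      rw [abs_mul, abs_mul, abs_of_pos hg] at e1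
      have e2 : |F m (x (2*i+1)) - F m (x (2*i))| ≤ 2 * ε := by
        have := abs_sub (F m (x (2*i+1))) (F m (x (2*i)))
        linarith [a1.2, a2.2]
      have e3 : 1/2 * |F (m+1) y| * s ≤ |(1/2 : ℝ) - m| * |F (m+1) y| * (x (2*i+1) - x (2*i)) := by
        gcongr
        · exact half_sub_abs m
        · linarith
      rw [div_mul_eq_mul_div, le_div_iff₀ hs]
      linarith
    choose y hy using key
    obtain ⟨z, hz, hz2⟩ := ih (m+1) (4/s*ε) y (fun i hi => ⟨(hy i hi).1, (hy i hi).2.1⟩) (by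
      intro i hi
      have b1 := (hy i (by omega)).2.2.2
      have b2 := (hy (i+1) hi).2.2.1
      have b3 := h2 (2*i+1) (by omega)
      have : 2*(i+1) = 2*i+1+1 := by ring
      rw [this] at b2
      linarith)
    refine ⟨z, hz, ?_⟩
    have : m + (n+1) = m+1+n := by ring
    rw [this, pow_succ, mul_assoc]
    exact hz2

lemma spaced_or_small (s : ℝ) (hs : 0 < s) : ∀ (n : ℕ) (S : Set ℝ), BddBelow S →
    (∃ x : ℕ → ℝ, (∀ i < n, x i ∈ S) ∧ ∀ i, i + 1 < n → x i + s ≤ x (i+1)) ∨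
      MeasureTheory.volume S ≤ ENNReal.ofReal (2 * n * s) := by
  intro n
  induction n with
  | zero => intro S _; left; exact ⟨fun _ => 0, by simp, by simp⟩
  | succ n ih =>
    intro S hS
    rcases S.eq_empty_or_nonempty with h | h
    · right; simp [h]
    obtain ⟨x0, hx0, hlt⟩ := exists_lt_of_csInf_lt h (show sInf S < sInf S + s by linarith)
    rcases ih (S ∩ Set.Ici (x0+s)) (hS.mono Set.inter_subset_left) with ⟨x, hx, hx2⟩ | hv
    · left
      refine ⟨fun i => Nat.casesOn i x0 x, ?_, ?_⟩
      · intro i hi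
        cases i with
        | zero => exact hx0
        | succ i => exact (hx i (by omega)).1
      · intro i hi
        cases i with
        | zero => exact (hx 0 (by omega)).2
        | succ i => exact hx2 i (by omega)
    · right
      have hsub : S ⊆ Set.Icc (sInf S) (x0+s) ∪ (S ∩ Set.Ici (x0+s)) := by
        intro z hz
        rcases le_total z (x0+s) with h' | h'
        · left; exact ⟨csInf_le hS hz, h'⟩
        · right; exact ⟨hz, h'⟩
      calc MeasureTheory.volume S ≤ _ := MeasureTheory.measure_mono hsub
        _ ≤ _ := MeasureTheory.measure_union_le _ _
        _ ≤ ENNReal.ofReal (2*s) + ENNReal.ofReal (2*n*s) := by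
          gcongr
          rw [Real.volume_Icc]
          apply ENNReal.ofReal_le_ofReal; linarith
        _ = ENNReal.ofReal (2 * (n+1 : ℕ) * s) := by
          rw [← ENNReal.ofReal_add (by positivity) (by positivity)]
          congr 1; push_cast; ring

lemma sublevel (F : ℕ → ℝ → ℝ) (a b : ℝ) (hab : a < b) (r : ℕ)
    (hF : ∀ m : ℕ, ∀ x ∈ Set.Ioo a b, HasDerivAt (F m) ((1/2 - (m:ℝ)) * F (m+1) x) x)
    (δ M : ℝ) (hδ : 0 < δ) (hM : 0 < M)
    (hM' : ∀ m ≤ r, ∀ x ∈ Set.Ioo a b, |(1/2 - (m:ℝ)) * F (m+1) x| ≤ M)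
    (hlow : ∀ x ∈ Set.Ioo a b, ∃ m ≤ r, δ ≤ |F m x|)
    (ε s : ℝ) (hε : 0 < ε) (hs : 0 < s) (hs1 : s ≤ 1) (hsε : (4/s)^r * ε < δ/2) :
    MeasureTheory.volume {x ∈ Set.Ioo a b | |F 0 x| ≤ ε} ≤
      ENNReal.ofReal ((2 * M * (b-a) / δ + 2) * (2 * 2^r * s)) := by
  set K : ℕ := ⌈2 * M * (b-a) / δ⌉₊ + 1 with hK
  have hL : 0 < b - a := by linarith
  have hKpos : (0:ℝ) < K := by positivity
  have hK1 : 2 * M * (b-a) / δ ≤ K := by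
    have := Nat.le_ceil (2 * M * (b-a) / δ); rw [hK]; push_cast; linarith
  have hK2 : (K:ℝ) ≤ 2 * M * (b-a) / δ + 2 := by
    have := Nat.ceil_lt_add_one (show 0 ≤ 2 * M * (b-a) / δ by positivity)
    rw [hK]; push_cast; linarith
  set h : ℝ := (b-a)/K with hh
  have hhpos : 0 < h := by positivity
  have hhK : h * K = b - a := by rw [hh]; field_simp
  have hMh : M * h ≤ δ/2 := by
    rw [div_le_iff₀ hδ] at hK1
    rw [hh, ← mul_div_assoc, div_le_iff₀ hKpos]
    linarith
  have hcov : {x ∈ Set.Ioo a b | |F 0 x| ≤ ε} ⊆ ⋃ i ∈ Finset.range K,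
      ({x ∈ Set.Ioo a b | |F 0 x| ≤ ε} ∩ Set.Icc (a + i*h) (a+(i+1)*h)) := by
    intro x hx
    have hx1 := hx.1.1
    have hx2 := hx.1.2
    have hnn : 0 ≤ (x-a)/h := div_nonneg (by linarith) hhpos.le
    have f1 := Nat.floor_le hnn
    have f2 := Nat.lt_floor_add_one ((x-a)/h)
    rw [le_div_iff₀ hhpos] at f1
    rw [div_lt_iff₀ hhpos] at f2
    simp only [Set.mem_iUnion, Finset.mem_range]
    refine ⟨⌊(x-a)/h⌋₊, ?_, hx, by linarith, by linarith⟩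
    rw [Nat.floor_lt hnn, div_lt_iff₀ hhpos, mul_comm, hhK]
    linarith
  have hpiece : ∀ i ∈ Finset.range K, MeasureTheory.volume
      ({x ∈ Set.Ioo a b | |F 0 x| ≤ ε} ∩ Set.Icc (a + i*h) (a+(i+1)*h)) ≤
        ENNReal.ofReal (2 * 2^r * s) := by
    intro i _
    set J : Set ℝ := Set.Ioo a b ∩ Set.Icc (a + i*h) (a+(i+1)*h) with hJdef
    have hJ : J.OrdConnected := Set.ordConnected_Ioo.inter Set.ordConnected_Icc
    rcases spaced_or_small s hs (2^r) ({x ∈ Set.Ioo a b | |F 0 x| ≤ ε} ∩ Set.Icc (a + i*h) (a+(i+1)*h))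
      ⟨a, fun z hz => hz.1.1.1.le⟩ with ⟨x, hx, hx2⟩ | hv
    · exfalso
      have hx0 := hx 0 (by positivity)
      obtain ⟨m, hm, hδm⟩ := hlow (x 0) hx0.1.1
      have hpw : 2^m ≤ 2^r := Nat.pow_le_pow_right (by norm_num) hm
      obtain ⟨y, hy, hy2⟩ := spaced_deriv F J hJ (fun m x hx => hF m x hx.1) s hs m 0 ε x
        (fun i hi => ⟨⟨(hx i (by omega)).1.1, (hx i (by omega)).2⟩, (hx i (by omega)).1.2⟩)
        (fun i hi => hx2 i (by omega))
      rw [zero_add] at hy2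
      have h3 : (4/s)^m * ε ≤ (4/s)^r * ε := by
        gcongr
        rw [le_div_iff₀ hs]; linarith
      have hx0J : x 0 ∈ J := ⟨hx0.1.1, hx0.2⟩
      have h4 := hJ.convex.norm_image_sub_le_of_norm_hasDerivWithin_le
        (fun z hz => (hF m z hz.1).hasDerivWithinAt) (fun z hz => hM' m hm z hz.1) hy hx0J
      rw [Real.norm_eq_abs, Real.norm_eq_abs] at h4
      have h5 : |x 0 - y| ≤ h := by
        rw [abs_le]
        have := hx0J.2.1; have := hx0J.2.2; have := hy.2.1; have := hy.2.2
        constructor <;> linarith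
      have h6 : M * |x 0 - y| ≤ M * h := by gcongr
      have h7 := abs_sub_abs_le_abs_sub (F m (x 0)) (F m y)
      linarith
    · simpa using hv
  calc _ ≤ _ := MeasureTheory.measure_mono hcov
    _ ≤ _ := MeasureTheory.measure_biUnion_finset_le _ _
    _ ≤ ∑ i ∈ Finset.range K, ENNReal.ofReal (2 * 2^r * s) := Finset.sum_le_sum hpiece
    _ = ENNReal.ofReal (K * (2 * 2^r * s)) := by
      rw [Finset.sum_const, Finset.card_range, nsmul_eq_mul, ENNReal.ofReal_mul (p := (K:ℝ)) (by positivity),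
        ENNReal.ofReal_natCast]
    _ ≤ _ := by
      apply ENNReal.ofReal_le_ofReal
      gcongr

lemma moments {ι : Type*} [Fintype ι] (u v : ι → ℝ) (η U : ℝ) (R : ℕ) (hU : 0 ≤ U)
    (hη : ∀ m ≤ R, |∑ l, v l * u l ^ m| ≤ η) (A : Finset ℝ) (hA : ∀ a ∈ A, |a| ≤ U) :
    ∀ m, m + A.card ≤ R → |∑ l, v l * u l ^ m * ∏ a ∈ A, (u l - a)| ≤ (1+U)^A.card * η := by
  induction A using Finset.induction_on with
  | empty => intro m hm; simpa using hη m (by simpa using hm)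
  | insert a A ha ih =>
    intro m hm
    rw [Finset.card_insert_of_notMem ha] at hm ⊢
    have ih' := ih (fun b hb => hA b (Finset.mem_insert_of_mem hb))
    have e1 := ih' m (by omega)
    have e2 := ih' (m+1) (by omega)
    have haU := hA a (Finset.mem_insert_self _ _)
    have : ∑ l, v l * u l ^ m * ∏ a ∈ insert a A, (u l - a) =
        (∑ l, v l * u l ^ (m+1) * ∏ a ∈ A, (u l - a)) - a * ∑ l, v l * u l ^ m * ∏ a ∈ A, (u l - a) := by
      rw [Finset.mul_sum, ← Finset.sum_sub_distrib]
      refine Finset.sum_congr rfl fun l _ => ?_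
      rw [Finset.prod_insert ha]; ring
    rw [this]
    calc _ ≤ |∑ l, v l * u l ^ (m+1) * ∏ a ∈ A, (u l - a)| + |a * ∑ l, v l * u l ^ m * ∏ a ∈ A, (u l - a)| := abs_sub _ _
      _ ≤ (1+U)^A.card * η + U * ((1+U)^A.card * η) := by
        rw [abs_mul]; gcongr
      _ = _ := by ring

lemma sum_symm (d : ℕ) (H : Fin d → Fin d → ℝ) (hH : ∀ i k, H i k = H k i) :
    ∑ i, ∑ k, H i k = ∑ i, ∑ k, if i ≤ k then H i k * (if i = k then 1 else 2) else 0 := by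
  have h1 : ∑ i, ∑ k, H i k = (∑ i, ∑ k, if i ≤ k then H i k else 0) +
      ∑ i, ∑ k, if k < i then H i k else 0 := by
    rw [← Finset.sum_add_distrib]
    refine Finset.sum_congr rfl fun i _ => ?_
    rw [← Finset.sum_add_distrib]
    refine Finset.sum_congr rfl fun k _ => ?_
    rcases le_or_gt i k with h | h
    · simp [h, not_lt.mpr h]
    · simp [h, not_le.mpr h]
  rw [h1, Finset.sum_comm (f := fun i k => if k < i then H i k else 0), ← Finset.sum_add_distrib]
  refine Finset.sum_congr rfl fun i _ => ?_
  rw [← Finset.sum_add_distrib]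
  refine Finset.sum_congr rfl fun k _ => ?_
  rcases lt_trichotomy i k with h | h | h
  · simp [h, h.le, h.ne, hH k i]; ring
  · simp [h]
  · simp [not_le.mpr h, h.le]


lemma entry_le {d : ℕ} (j : Zd d) (N : ℕ) (h : enorm j ≤ (N:ℝ)) (i : Fin d) : |(j i : ℝ)| ≤ N := by
  refine le_trans ?_ h
  unfold enorm
  apply Real.abs_le_sqrt
  exact Finset.single_le_sum (f := fun i => (j i : ℝ)^2) (fun i _ => sq_nonneg _) (Finset.mem_univ i)

lemma qform_le (d : ℕ) (g : Fin d → Fin d → ℝ) (j : Zd d) (N : ℕ) (h : enorm j ≤ (N:ℝ)) :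
    qform d g j ≤ (∑ i, ∑ k, |g i k|) * (N:ℝ)^2 := by
  unfold qform
  rw [Finset.sum_mul]
  refine Finset.sum_le_sum fun i _ => ?_
  rw [Finset.sum_mul]
  refine Finset.sum_le_sum fun k _ => ?_
  refine (le_abs_self _).trans ?_
  rw [abs_mul, abs_mul, mul_assoc, sq]
  have := entry_le j N h i
  have := entry_le j N h k
  gcongr

lemma qform_nonneg (d : ℕ) (g : Fin d → Fin d → ℝ)
    (hpos : ∀ x : Fin d → ℝ, x ≠ 0 → 0 < ∑ i, ∑ k, g i k * x i * x k) (j : Zd d) :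
    0 ≤ qform d g j := by
  unfold qform
  by_cases h : (fun i => (j i : ℝ)) = 0
  · have : ∀ i, (j i : ℝ) = 0 := fun i => congrFun h i
    simp [this]
  · exact (hpos _ h).le

lemma qform_gap (d : ℕ) (g : Fin d → Fin d → ℝ) (hsym : ∀ i k, g i k = g k i) (γ₀ : ℝ)
    (hγ : 0 < γ₀) (hD : Diophantine d g γ₀) (j j' : Zd d) (N : ℕ) (hj : enorm j ≤ (N:ℝ))
    (hj' : enorm j' ≤ (N:ℝ)) (hne : qform d g j ≠ qform d g j') :
    γ₀ / (4 * (d:ℝ)^2 * (N:ℝ)^2) ^ tauStar d ≤ |qform d g j - qform d g j'| := by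
  set ℓ : Fin d → Fin d → ℤ := fun i k => (j i * j k - j' i * j' k) * (if i = k then 1 else 2) with hℓ
  have hq : qform d g j - qform d g j' = ∑ i, ∑ k, if i ≤ k then g i k * (ℓ i k : ℝ) else 0 := by
    have : qform d g j - qform d g j' = ∑ i, ∑ k, g i k * ((j i : ℝ) * j k - j' i * j' k) := by
      unfold qform
      rw [← Finset.sum_sub_distrib]
      refine Finset.sum_congr rfl fun i _ => ?_
      rw [← Finset.sum_sub_distrib]
      refine Finset.sum_congr rfl fun k _ => ?_
      ring
    rw [this, sum_symm]
    · refine Finset.sum_congr rfl fun i _ => Finset.sum_congr rfl fun k _ => ?_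
      simp only [hℓ]
      push_cast
      rw [mul_assoc]
    · intro i k; rw [hsym i k]; ring
  have hex : ∃ i k, i ≤ k ∧ ℓ i k ≠ 0 := by
    by_contra hcon
    push Not at hcon
    apply hne
    rw [← sub_eq_zero, hq]
    refine Finset.sum_eq_zero fun i _ => Finset.sum_eq_zero fun k _ => ?_
    split_ifs with h
    · simp [hcon i k h]
    · rfl
  have hDℓ := hD ℓ hex
  rw [hq]
  refine le_trans ?_ hDℓ
  have hposS : 0 < ∑ i, ∑ k, if i ≤ k then (|ℓ i k| : ℝ) else 0 := by
    obtain ⟨i, k, hik, hne0⟩ := hex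
    have hnn : ∀ i k, (0:ℝ) ≤ if i ≤ k then (|ℓ i k| : ℝ) else 0 := by
      intro i k; split_ifs <;> positivity
    refine Finset.sum_pos' (fun i _ => Finset.sum_nonneg fun k _ => hnn i k) ⟨i, Finset.mem_univ _, ?_⟩
    refine Finset.sum_pos' (fun k _ => hnn i k) ⟨k, Finset.mem_univ _, ?_⟩
    rw [if_pos hik]
    have : (ℓ i k : ℝ) ≠ 0 := by exact_mod_cast hne0
    positivity
  have hle : (∑ i, ∑ k, if i ≤ k then (|ℓ i k| : ℝ) else 0) ≤ 4 * (d:ℝ)^2 * (N:ℝ)^2 := by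
    have : ∀ i k, (if i ≤ k then (|ℓ i k| : ℝ) else 0) ≤ 4 * (N:ℝ)^2 := by
      intro i k
      split_ifs with h
      swap
      · positivity
      have a1 := entry_le j N hj i
      have a2 := entry_le j N hj k
      have a3 := entry_le j' N hj' i
      have a4 := entry_le j' N hj' k
      simp only [hℓ]
      push_cast
      rw [abs_mul]
      have e1 : |(j i : ℝ) * j k - j' i * j' k| ≤ 2 * (N:ℝ)^2 := by
        refine (abs_sub _ _).trans ?_
        rw [abs_mul, abs_mul]
        have : |(j i : ℝ)| * |(j k:ℝ)| ≤ N * N := by gcongr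
        have : |(j' i : ℝ)| * |(j' k:ℝ)| ≤ N * N := by gcongr
        nlinarith
      have e2 : |(if i = k then (1:ℝ) else 2)| ≤ 2 := by split_ifs <;> norm_num
      calc _ ≤ (2 * (N:ℝ)^2) * 2 := by gcongr
        _ = _ := by ring
    calc _ ≤ ∑ i : Fin d, ∑ k : Fin d, 4 * (N:ℝ)^2 := Finset.sum_le_sum fun i _ => Finset.sum_le_sum fun k _ => this i k
      _ = _ := by simp; ring
  gcongr

noncomputable def momF {r : ℕ} (b : Fin r → ℝ) (σ : Fin r → ℤ) (m : ℕ) (ζ : ℝ) : ℝ :=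
  ∑ l, (σ l : ℝ) * Real.sqrt (b l + ζ) * ((b l + ζ)⁻¹)^m

lemma momF_deriv {r : ℕ} (b : Fin r → ℝ) (σ : Fin r → ℤ) (hb : ∀ l, 0 ≤ b l) (m : ℕ) (ζ : ℝ)
    (hζ : 0 < ζ) : HasDerivAt (momF b σ m) ((1/2 - (m:ℝ)) * momF b σ (m+1) ζ) ζ := by
  have key : ∀ l ∈ (Finset.univ : Finset (Fin r)), HasDerivAt
      (fun ζ => (σ l : ℝ) * Real.sqrt (b l + ζ) * ((b l + ζ)⁻¹)^m)
      ((1/2 - (m:ℝ)) * ((σ l : ℝ) * Real.sqrt (b l + ζ) * ((b l + ζ)⁻¹)^(m+1))) ζ := by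
    intro l _
    have hx : 0 < b l + ζ := by linarith [hb l]
    have h0 : HasDerivAt (fun ζ => b l + ζ) 1 ζ := (hasDerivAt_id ζ).const_add (b l)
    have h1 := (h0.sqrt hx.ne').const_mul (σ l : ℝ)
    have h2 := (h0.fun_inv hx.ne').fun_pow m
    have h3 := h1.fun_mul h2
    refine h3.congr_deriv ?_
    set X := b l + ζ with hX
    have hsq : Real.sqrt X ^ 2 = X := Real.sq_sqrt hx.le
    have hsp : 0 < Real.sqrt X := Real.sqrt_pos.mpr hx
    set w := Real.sqrt X
    rw [← hsq]
    rcases m with _ | m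
    · simp; field_simp
    · push_cast
      simp only [inv_pow, pow_succ]
      field_simp
      ring
  have := HasDerivAt.fun_sum key
  rw [← Finset.mul_sum] at this
  exact this

lemma momF_upper {r : ℕ} (b : Fin r → ℝ) (σ : Fin r → ℤ) (hb : ∀ l, 0 ≤ b l)
    (hσ : ∀ l, σ l = 1 ∨ σ l = -1) (B : ℝ) (hB : ∀ l, b l ≤ B) (z Z ζ : ℝ) (hz : 0 < z)
    (hζ : z ≤ ζ) (hZ : ζ ≤ Z) (m : ℕ) (hm : m ≤ r) :
    |(1/2 - (m:ℝ)) * momF b σ (m+1) ζ| ≤ (r+1) * (r * ((1 + B + Z) * (1+z⁻¹)^(r+1))) := by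
  have hz' : 0 < z⁻¹ := by positivity
  rw [abs_mul]
  have h1 : |(1/2 : ℝ) - m| ≤ r + 1 := by
    have : (m:ℝ) ≤ r := by exact_mod_cast hm
    have : (0:ℝ) ≤ m := by positivity
    rw [abs_le]; constructor <;> linarith
  have h2 : |momF b σ (m+1) ζ| ≤ r * ((1 + B + Z) * (1+z⁻¹)^(r+1)) := by
    unfold momF
    refine (Finset.abs_sum_le_sum_abs _ _).trans ?_
    calc _ ≤ ∑ l : Fin r, (1 + B + Z) * (1+z⁻¹)^(r+1) := by
          refine Finset.sum_le_sum fun l _ => ?_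
          have hx : 0 < b l + ζ := by linarith [hb l]
          have s1 : |(σ l : ℝ)| = 1 := by rcases hσ l with h | h <;> simp [h]
          rw [abs_mul, abs_mul, s1, one_mul, abs_of_nonneg (Real.sqrt_nonneg _), abs_of_nonneg (by positivity)]
          have s2 : Real.sqrt (b l + ζ) ≤ 1 + B + Z := by
            rw [Real.sqrt_le_left (by linarith [hB l])]
            nlinarith [hB l]
          have s3 : (b l + ζ)⁻¹ ≤ 1 + z⁻¹ := by
            have : (b l + ζ)⁻¹ ≤ z⁻¹ := by
              apply inv_anti₀ hz; linarith [hb l]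
            linarith
          have s4 : ((b l + ζ)⁻¹)^(m+1) ≤ (1+z⁻¹)^(r+1) := by
            calc _ ≤ (1+z⁻¹)^(m+1) := by gcongr
              _ ≤ _ := by
                apply pow_le_pow_right₀
                · linarith
                · omega
          have : 0 ≤ 1 + B + Z := by linarith [hB l]
          gcongr
      _ = _ := by simp
  gcongr

lemma momF_lower {r : ℕ} (b : Fin r → ℝ) (σ : Fin r → ℤ) (hb : ∀ l, 0 ≤ b l)
    (B : ℝ) (hB : ∀ l, b l ≤ B) (z Z ζ : ℝ) (hz : 0 < z)
    (hζ : z ≤ ζ) (hZ : ζ ≤ Z) (κ : ℝ) (hκ : 0 < κ) (hκ1 : κ ≤ 1)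
    (hgap : ∀ l l', b l ≠ b l' → κ * (B + Z)^2 ≤ |b l - b l'|)
    (l0 : Fin r) (hl0 : ∑ l with b l = b l0, σ l ≠ 0) :
    ∃ m ≤ r, Real.sqrt z * κ^r / (1+z⁻¹)^r / 2 ≤ |momF b σ m ζ| := by
  by_contra hcon
  push Not at hcon
  have hz' : 0 < z⁻¹ := by positivity
  have hsz : 0 < Real.sqrt z := Real.sqrt_pos.mpr hz
  set δ := Real.sqrt z * κ^r / (1+z⁻¹)^r / 2 with hδ
  set A : Finset ℝ := ((Finset.univ.image b).erase (b l0)).image (fun a => (a+ζ)⁻¹) with hA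
  have hmemA : ∀ a ∈ A, ∃ l, b l ≠ b l0 ∧ a = (b l + ζ)⁻¹ := by
    intro a ha
    simp only [hA, Finset.mem_image, Finset.mem_erase, Finset.mem_univ, true_and] at ha
    obtain ⟨_, ⟨hne, l, rfl⟩, rfl⟩ := ha
    exact ⟨l, hne, rfl⟩
  have hcard : A.card ≤ r := by
    calc A.card ≤ _ := Finset.card_image_le
      _ ≤ _ := Finset.card_erase_le
      _ ≤ _ := Finset.card_image_le
      _ = r := by simp
  have hx : ∀ l, 0 < b l + ζ := fun l => by linarith [hb l]
  have hm := moments (fun l => (b l + ζ)⁻¹) (fun l => (σ l : ℝ) * Real.sqrt (b l + ζ)) δ z⁻¹ r hz'.le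
    (fun m hm => (hcon m hm).le) A (by
      intro a ha
      obtain ⟨l, _, rfl⟩ := hmemA a ha
      rw [abs_of_pos (inv_pos.mpr (hx l))]
      apply inv_anti₀ hz; linarith [hb l]) 0 (by omega)
  have hsum : ∑ l, (σ l : ℝ) * Real.sqrt (b l + ζ) * ((b l + ζ)⁻¹)^0 * ∏ a ∈ A, ((b l + ζ)⁻¹ - a) =
      ((∑ l with b l = b l0, σ l : ℤ) : ℝ) * (Real.sqrt (b l0 + ζ) * ∏ a ∈ A, ((b l0 + ζ)⁻¹ - a)) := by
    push_cast
    rw [Finset.sum_mul, Finset.sum_filter]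
    refine Finset.sum_congr rfl fun l _ => ?_
    split_ifs with h
    · rw [h]; ring
    · have : (b l + ζ)⁻¹ ∈ A := by
        simp only [hA, Finset.mem_image, Finset.mem_erase, Finset.mem_univ, true_and]
        exact ⟨b l, ⟨h, l, rfl⟩, rfl⟩
      rw [Finset.prod_eq_zero this (sub_self _), mul_zero]
  rw [hsum, abs_mul, abs_mul, abs_of_nonneg (Real.sqrt_nonneg _), Finset.abs_prod] at hm
  have h1 : (1:ℝ) ≤ |((∑ l with b l = b l0, σ l : ℤ) : ℝ)| := by
    exact_mod_cast Int.one_le_abs hl0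
  have h2 : Real.sqrt z ≤ Real.sqrt (b l0 + ζ) := Real.sqrt_le_sqrt (by linarith [hb l0])
  have h3 : κ ^ A.card ≤ ∏ a ∈ A, |(b l0 + ζ)⁻¹ - a| := by
    rw [← Finset.prod_const]
    refine Finset.prod_le_prod (fun _ _ => hκ.le) fun a ha => ?_
    obtain ⟨l, hne, rfl⟩ := hmemA a ha
    have x1 := hx l
    have x0 := hx l0
    rw [inv_sub_inv x0.ne' x1.ne', abs_div, abs_of_pos (mul_pos x0 x1), le_div_iff₀ (mul_pos x0 x1)]
    have g := hgap l l0 hne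
    have : b l + ζ - (b l0 + ζ) = b l - b l0 := by ring
    rw [this]
    refine le_trans ?_ g
    rw [sq]
    have := hB l
    have := hB l0
    have : 0 ≤ B + Z := by linarith
    gcongr
  have h4 : κ^r ≤ κ^A.card := pow_le_pow_of_le_one hκ.le hκ1 hcard
  have h5 : (1+z⁻¹)^A.card * δ ≤ (1+z⁻¹)^r * δ := by
    have : 0 < δ := by positivity
    gcongr
    linarith
  have h6 : (1+z⁻¹)^r * δ = Real.sqrt z * κ^r / 2 := by
    rw [hδ]; field_simp
  have h7 : 1 * (Real.sqrt z * κ^r) ≤ |((∑ l with b l = b l0, σ l : ℤ) : ℝ)| *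
      (Real.sqrt (b l0 + ζ) * ∏ a ∈ A, |(b l0 + ζ)⁻¹ - a|) := by
    gcongr
    exact h4.trans h3
  have : 0 < Real.sqrt z * κ^r := by positivity
  linarith

lemma momF_trivial {r : ℕ} (b : Fin r → ℝ) (σ : Fin r → ℤ)
    (h : ∀ l0, ∑ l with b l = b l0, σ l = 0) (ζ : ℝ) : momF b σ 0 ζ = 0 := by
  unfold momF
  rw [← Finset.sum_fiberwise_of_maps_to (s := Finset.univ) (t := Finset.univ.image b) (g := b)
    (fun l hl => Finset.mem_image_of_mem b hl)]
  refine Finset.sum_eq_zero fun y hy => ?_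
  obtain ⟨l0, _, rfl⟩ := Finset.mem_image.mp hy
  have : ∑ l with b l = b l0, (σ l : ℝ) * Real.sqrt (b l + ζ) * ((b l + ζ)⁻¹)^0 =
      ((∑ l with b l = b l0, σ l : ℤ) : ℝ) * Real.sqrt (b l0 + ζ) := by
    push_cast
    rw [Finset.sum_mul]
    refine Finset.sum_congr rfl fun l hl => ?_
    rw [(Finset.mem_filter.mp hl).2]; simp
  rw [this, h l0]; simp


lemma single (d : ℕ) (hd : 1 ≤ d)
    (gbar : Fin d → Fin d → ℝ) (hsym : ∀ i k, gbar i k = gbar k i)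
    (hpos : ∀ x : Fin d → ℝ, x ≠ 0 → 0 < ∑ i, ∑ k, gbar i k * x i * x k)
    (hadm : ∃ γ₀ : ℝ, 0 < γ₀ ∧ Diophantine d gbar γ₀)
    (ζ₁ ζ₂ : ℝ) (hζ₁ : 0 < ζ₁) (hζ₁₂ : ζ₁ < ζ₂) (r : ℕ) (hr : 1 ≤ r) :
    ∃ δ₀ M₀ : ℝ, ∃ T : ℕ, 0 < δ₀ ∧ 0 < M₀ ∧ ∀ N : ℕ, 1 ≤ N →
      ∀ (j : Fin r → Zd d) (σ : Fin r → ℤ),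
        (∀ l, σ l = 1 ∨ σ l = -1) → (∀ l, enorm (j l) ≤ (N : ℝ)) →
        (∃ l0, ∑ l with (qform d gbar (j l))^2 = (qform d gbar (j l0))^2, σ l ≠ 0) →
        (∀ ζ ∈ Set.Ioo ζ₁ ζ₂, ∃ m ≤ r, δ₀ / (N:ℝ)^T ≤ |momF (fun l => (qform d gbar (j l))^2) σ m ζ|) ∧
        (∀ m ≤ r, ∀ ζ ∈ Set.Ioo ζ₁ ζ₂,
          |(1/2 - (m:ℝ)) * momF (fun l => (qform d gbar (j l))^2) σ (m+1) ζ| ≤ M₀ * (N:ℝ)^4) := by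
  obtain ⟨γ₀, hγ₀, hD⟩ := hadm
  set t := tauStar d with ht
  set G : ℝ := ∑ i, ∑ k, |gbar i k| with hG
  have hG0 : 0 ≤ G := Finset.sum_nonneg fun i _ => Finset.sum_nonneg fun k _ => abs_nonneg _
  have hζ₂ : 0 < ζ₂ := by linarith
  have hdR : (0:ℝ) < d := by exact_mod_cast hd
  have hrR : (0:ℝ) < r := by exact_mod_cast hr
  set κ₀ : ℝ := min 1 ((γ₀ / (4 * (d:ℝ)^2)^t)^2 / (G^2 + ζ₂)^2) with hκ₀
  have hκ₀pos : 0 < κ₀ := by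
    rw [hκ₀]; apply lt_min one_pos; positivity
  have hκ₀1 : κ₀ ≤ 1 := min_le_left _ _
  have hκ₀2 : κ₀ * (G^2+ζ₂)^2 ≤ (γ₀ / (4 * (d:ℝ)^2)^t)^2 := by
    rw [← le_div_iff₀ (by positivity)]; exact min_le_right _ _
  have hz' : 0 < ζ₁⁻¹ := by positivity
  refine ⟨Real.sqrt ζ₁ * κ₀^r / (1+ζ₁⁻¹)^r / 2,
    (r+1) * (r * ((1 + G^2 + ζ₂) * (1+ζ₁⁻¹)^(r+1))), (4*t+8)*r, ?_, by positivity, ?_⟩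
  · have := Real.sqrt_pos.mpr hζ₁
    positivity
  intro N hN j σ hσ hj ⟨l0, hl0⟩
  have hN1 : (1:ℝ) ≤ N := by exact_mod_cast hN
  have hN0 : (0:ℝ) < N := by linarith
  have hN4 : (1:ℝ) ≤ (N:ℝ)^4 := one_le_pow₀ hN1
  have hb : ∀ l, 0 ≤ (qform d gbar (j l))^2 := fun l => sq_nonneg _
  have hB : ∀ l, (qform d gbar (j l))^2 ≤ G^2 * (N:ℝ)^4 := by
    intro l
    have h1 := qform_le d gbar (j l) N (hj l)
    have h2 := qform_nonneg d gbar hpos (j l)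
    calc _ ≤ (G * (N:ℝ)^2)^2 := by gcongr
      _ = _ := by ring
  constructor
  · intro ζ hζ
    have hgap : ∀ l l', (qform d gbar (j l))^2 ≠ (qform d gbar (j l'))^2 →
        (κ₀ / (N:ℝ)^(4*t+8)) * (G^2 * (N:ℝ)^4 + ζ₂)^2 ≤ |(qform d gbar (j l))^2 - (qform d gbar (j l'))^2| := by
      intro l l' hne
      have hne' : qform d gbar (j l) ≠ qform d gbar (j l') := fun h => hne (by rw [h])
      have g1 := qform_gap d gbar hsym γ₀ hγ₀ hD (j l) (j l') N (hj l) (hj l') hne'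
      have p1 := qform_nonneg d gbar hpos (j l)
      have p2 := qform_nonneg d gbar hpos (j l')
      have e1 : |qform d gbar (j l) - qform d gbar (j l')|^2 ≤
          |(qform d gbar (j l))^2 - (qform d gbar (j l'))^2| := by
        rw [sq_sub_sq, abs_mul, mul_comm, sq]
        refine mul_le_mul_of_nonneg_left ?_ (abs_nonneg _)
        rw [abs_of_nonneg (by positivity : 0 ≤ qform d gbar (j l) + qform d gbar (j l')), abs_le]
        constructor <;> linarith
      refine le_trans ?_ e1
      have e2 : (γ₀ / (4 * (d:ℝ)^2 * (N:ℝ)^2) ^ t)^2 ≤ |qform d gbar (j l) - qform d gbar (j l')|^2 := by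
        gcongr
      refine le_trans ?_ e2
      have e3 : G^2 * (N:ℝ)^4 + ζ₂ ≤ (G^2 + ζ₂) * (N:ℝ)^4 := by nlinarith
      calc (κ₀ / (N:ℝ)^(4*t+8)) * (G^2 * (N:ℝ)^4 + ζ₂)^2
          ≤ (κ₀ / (N:ℝ)^(4*t+8)) * ((G^2 + ζ₂) * (N:ℝ)^4)^2 := by gcongr
        _ = (κ₀ * (G^2+ζ₂)^2) / (N:ℝ)^(4*t) := by
          rw [pow_add]; field_simp
        _ ≤ (γ₀ / (4 * (d:ℝ)^2)^t)^2 / (N:ℝ)^(4*t) := by gcongr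
        _ = _ := by
          rw [mul_pow (4 * (d:ℝ)^2), ← pow_mul, div_pow, div_pow, mul_pow _ ((N:ℝ)^(2*t)), ← pow_mul (N:ℝ), div_div]
          congr 3
          ring
    obtain ⟨m, hm, hle⟩ := momF_lower (fun l => (qform d gbar (j l))^2) σ hb (G^2 * (N:ℝ)^4) hB ζ₁ ζ₂ ζ
      hζ₁ hζ.1.le hζ.2.le (κ₀ / (N:ℝ)^(4*t+8)) (by positivity) (by
        rw [div_le_one (by positivity)]
        exact hκ₀1.trans (one_le_pow₀ hN1)) hgap l0 hl0
    refine ⟨m, hm, le_of_eq_of_le ?_ hle⟩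
    rw [div_pow, ← pow_mul]
    field_simp
  · intro m hm ζ hζ
    refine (momF_upper (fun l => (qform d gbar (j l))^2) σ hb hσ (G^2 * (N:ℝ)^4) hB ζ₁ ζ₂ ζ
      hζ₁ hζ.1.le hζ.2.le m hm).trans ?_
    have : 1 + G^2 * (N:ℝ)^4 + ζ₂ ≤ (1 + G^2 + ζ₂) * (N:ℝ)^4 := by nlinarith
    calc _ ≤ (r+1) * (r * (((1 + G^2 + ζ₂) * (N:ℝ)^4) * (1+ζ₁⁻¹)^(r+1))) := by gcongr
      _ = _ := by ring

lemma beam_eq (d : ℕ) (gbar : Fin d → Fin d → ℝ) (r : ℕ) (j : Fin r → Zd d) (σ : Fin r → ℤ) (ζ : ℝ) :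
    ∑ l, (σ l : ℝ) * beamFreq d gbar (j l) ζ = momF (fun l => (qform d gbar (j l))^2) σ 0 ζ := by
  simp [momF, beamFreq]

theorem stmt_15 (d : ℕ) (hd : 1 ≤ d)
    (gbar : Fin d → Fin d → ℝ) (hsym : ∀ i k, gbar i k = gbar k i)
    (hpos : ∀ x : Fin d → ℝ, x ≠ 0 → 0 < ∑ i, ∑ k, gbar i k * x i * x k)
    (hadm : ∃ γ₀ : ℝ, 0 < γ₀ ∧ Diophantine d gbar γ₀)
    (ζ₁ ζ₂ : ℝ) (hζ₁ : 0 < ζ₁) (hζ₁₂ : ζ₁ < ζ₂) (r : ℕ) (hr : 1 ≤ r) :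
    ∃ τ : ℝ, ∃ C : ℝ, 0 < C ∧ ∃ γmax : ℝ, 0 < γmax ∧
      ∀ γ : ℝ, 0 < γ → γ < γmax →
        ∃ I : Set ℝ, MeasurableSet I ∧ I ⊆ Set.Ioo ζ₁ ζ₂ ∧
          MeasureTheory.volume (Set.Ioo ζ₁ ζ₂ \ I)
            ≤ ENNReal.ofReal (C * γ ^ (1 / (r : ℝ))) ∧
          ∀ ζ ∈ I, ∀ N : ℕ, 1 ≤ N →
            ∀ (j : Fin r → Zd d) (σ : Fin r → ℤ),
              (∀ l, σ l = 1 ∨ σ l = -1) → (∀ l, enorm (j l) ≤ (N : ℝ)) →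
              (∑ l, (σ l : ℝ) * beamFreq d gbar (j l) ζ) ≠ 0 →
              γ / (N : ℝ) ^ τ ≤ |∑ l, (σ l : ℝ) * beamFreq d gbar (j l) ζ| := by
  obtain ⟨δ₀, M₀, T, hδ₀, hM₀, hmain⟩ := single d hd gbar hsym hpos hadm ζ₁ ζ₂ hζ₁ hζ₁₂ r hr
  have hL : 0 < ζ₂ - ζ₁ := by linarith
  have hrR : (0:ℝ) < r := by exact_mod_cast hr
  set p : ℕ := (4 + T) + d * r + 2 with hp
  set κ : ℝ := 4 * 4^r / δ₀ with hκ
  have hκpos : 0 < κ := by positivity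
  set K₀ : ℝ := 2 * M₀ * (ζ₂ - ζ₁) / δ₀ + 2 with hK₀
  have hK₀pos : 0 < K₀ := by positivity
  -- constant for a single `N`
  set D : ℝ := (3:ℝ)^(d*r) * 2^r * (K₀ * (2 * 2^r * κ ^ (1 / (r:ℝ)))) with hDdef
  have hDpos : 0 < D := by positivity
  have hsummable : Summable (fun N : ℕ => 1 / ((N:ℝ)+1)^2) := by
    have := (summable_nat_add_iff 1).mpr (Real.summable_one_div_nat_pow.mpr (show 1 < 2 by norm_num))
    simpa using this
  have hSpos : 0 ≤ ∑' N : ℕ, 1 / ((N:ℝ)+1)^2 := tsum_nonneg fun N => by positivity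
  refine ⟨((T + r * p : ℕ) : ℝ), D * (∑' N : ℕ, 1 / ((N:ℝ)+1)^2) + 1, by positivity, 1/κ, by positivity, ?_⟩
  intro γ hγ hγm
  have hκγ : κ * γ ≤ 1 := by
    rw [lt_div_iff₀ hκpos] at hγm; linarith
  set s₀ : ℝ := (κ * γ) ^ (1 / (r:ℝ)) with hs₀
  have hs₀pos : 0 < s₀ := by positivity
  have hs₀1 : s₀ ≤ 1 := Real.rpow_le_one (by positivity) hκγ (by positivity)
  have hs₀r : s₀ ^ r = κ * γ := by
    rw [hs₀, one_div, Real.rpow_inv_natCast_pow (by positivity) (by omega)]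
  have hs₀' : s₀ = κ ^ (1/(r:ℝ)) * γ ^ (1/(r:ℝ)) := Real.mul_rpow hκpos.le hγ.le
  let b : (Fin r → Zd d) → Fin r → ℝ := fun j l => (qform d gbar (j l))^2
  let bad : ℕ → (Fin r → Zd d) → (Fin r → ℤ) → Set ℝ := fun N j σ =>
    {ζ | ζ ∈ Set.Ioo ζ₁ ζ₂ ∧ momF (b j) σ 0 ζ ≠ 0 ∧ |momF (b j) σ 0 ζ| < γ / (N:ℝ)^(T + r*p)}
  have hcont : ∀ j σ, Measurable (momF (b j) σ 0) := by
    intro j σ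
    unfold momF
    fun_prop
  have hbadmeas : ∀ N j σ, MeasurableSet (bad N j σ) := by
    intro N j σ
    refine measurableSet_Ioo.inter (MeasurableSet.inter ?_ ?_)
    · exact (hcont j σ) (measurableSet_singleton 0).compl
    · exact measurableSet_lt (hcont j σ).abs measurable_const
  have hbad : ∀ N : ℕ, 1 ≤ N → ∀ j σ, (∀ l, σ l = 1 ∨ σ l = -1) → (∀ l, enorm (j l) ≤ (N : ℝ)) →
      MeasureTheory.volume (bad N j σ) ≤
        ENNReal.ofReal (K₀ * (N:ℝ)^(4+T) * (2 * 2^r * (s₀ / (N:ℝ)^p))) := by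
    intro N hN j σ hσ hj
    have hN1 : (1:ℝ) ≤ N := by exact_mod_cast hN
    have hN0 : (0:ℝ) < N := by linarith
    by_cases hex : ∃ l0, ∑ l with b j l = b j l0, σ l ≠ 0
    swap
    · push Not at hex
      have : bad N j σ = ∅ := by
        ext ζ
        simp only [bad, Set.mem_ofPred_eq, Set.mem_empty_iff_false, iff_false]
        rintro ⟨_, h, _⟩
        exact h (momF_trivial (b j) σ hex ζ)
      rw [this]; simp
    obtain ⟨hlow, hup⟩ := hmain N hN j σ hσ hj hex
    have hsub := sublevel (momF (b j) σ) ζ₁ ζ₂ hζ₁₂ r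
      (fun m x hx => momF_deriv (b j) σ (fun l => sq_nonneg _) m x (hζ₁.trans hx.1))
      (δ₀ / (N:ℝ)^T) (M₀ * (N:ℝ)^4) (by positivity) (by positivity) hup hlow
      (γ / (N:ℝ)^(T + r*p)) (s₀ / (N:ℝ)^p) (by positivity) (by positivity) (by
        rw [div_le_one (by positivity)]
        exact hs₀1.trans (one_le_pow₀ hN1)) (by
        have : (4 / (s₀ / (N:ℝ)^p))^r * (γ / (N:ℝ)^(T + r*p)) = δ₀ / (N:ℝ)^T / 4 := by
          rw [div_pow, div_pow, hs₀r, hκ, ← pow_mul, pow_add, mul_comm p r]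
          field_simp
        rw [this]
        have : 0 < δ₀ / (N:ℝ)^T := by positivity
        linarith)
    refine (MeasureTheory.measure_mono ?_).trans (hsub.trans ?_)
    · intro ζ hζ
      exact ⟨hζ.1, hζ.2.2.le⟩
    · apply ENNReal.ofReal_le_ofReal
      gcongr
      have h1 : 2 * (M₀ * (N:ℝ)^4) * (ζ₂ - ζ₁) / (δ₀ / (N:ℝ)^T) =
          (2 * M₀ * (ζ₂ - ζ₁) / δ₀) * (N:ℝ)^(4+T) := by
        rw [pow_add]; field_simp
      rw [h1, hK₀, add_mul]
      have : (1:ℝ) ≤ (N:ℝ)^(4+T) := one_le_pow₀ hN1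
      linarith
  classical
  let js : ℕ → Finset (Fin r → Zd d) := fun N =>
    Fintype.piFinset fun _ => Fintype.piFinset fun _ => Finset.Icc (-(N:ℤ)) N
  let σs : Finset (Fin r → ℤ) := Fintype.piFinset fun _ => ({1, -1} : Finset ℤ)
  have hjs : ∀ N, (js N).card = (2*N+1)^(d*r) := by
    intro N
    simp only [js, Fintype.card_piFinset, Int.card_Icc, Finset.prod_const, Finset.card_univ, Fintype.card_fin]
    rw [← pow_mul]
    congr 1
    omega
  have hσs : σs.card = 2^r := by
    simp [σs, Fintype.card_piFinset]
  let badN : ℕ → Set ℝ := fun N => ⋃ q ∈ ((js N) ×ˢ σs).filter (fun q => ∀ l, enorm (q.1 l) ≤ (N:ℝ)),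
    bad N q.1 q.2
  have hbadN : ∀ N : ℕ, 1 ≤ N → MeasureTheory.volume (badN N) ≤
      ENNReal.ofReal (D * γ^(1/(r:ℝ)) * (1 / (N:ℝ)^2)) := by
    intro N hN
    have hN1 : (1:ℝ) ≤ N := by exact_mod_cast hN
    have hN0 : (0:ℝ) < N := by linarith
    set E : ℝ := K₀ * (N:ℝ)^(4+T) * (2 * 2^r * (s₀ / (N:ℝ)^p)) with hE
    have hE0 : 0 ≤ E := by positivity
    calc MeasureTheory.volume (badN N) ≤ _ := MeasureTheory.measure_biUnion_finset_le _ _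
      _ ≤ ∑ q ∈ ((js N) ×ˢ σs).filter (fun q => ∀ l, enorm (q.1 l) ≤ (N:ℝ)), ENNReal.ofReal E := by
        refine Finset.sum_le_sum fun q hq => ?_
        rw [Finset.mem_filter, Finset.mem_product] at hq
        refine hbad N hN q.1 q.2 (fun l => ?_) hq.2
        have := Fintype.mem_piFinset.mp hq.1.2 l
        simpa using this
      _ ≤ ∑ q ∈ (js N) ×ˢ σs, ENNReal.ofReal E :=
        Finset.sum_le_sum_of_subset (Finset.filter_subset _ _)
      _ = ENNReal.ofReal ((((2*N+1)^(d*r) * 2^r : ℕ) : ℝ) * E) := by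
        rw [Finset.sum_const, Finset.card_product, hjs, hσs, nsmul_eq_mul,
          ENNReal.ofReal_mul (p := (((2*N+1)^(d*r) * 2^r : ℕ) : ℝ)) (Nat.cast_nonneg _),
          ENNReal.ofReal_natCast]
      _ ≤ _ := by
        apply ENNReal.ofReal_le_ofReal
        push_cast
        calc (2*(N:ℝ)+1)^(d*r) * 2^r * E ≤ (3 * (N:ℝ))^(d*r) * 2^r * E := by
              gcongr; linarith
          _ = _ := by
            rw [hE, hDdef, hs₀', hp, mul_pow, pow_add (N:ℝ) (4 + T + d*r), pow_add (N:ℝ) (4+T) (d*r)]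
            field_simp
  refine ⟨Set.Ioo ζ₁ ζ₂ \ ⋃ N : ℕ, badN (N+1), ?_, Set.sdiff_subset, ?_, ?_⟩
  · refine measurableSet_Ioo.diff (MeasurableSet.iUnion fun N => ?_)
    exact Finset.measurableSet_biUnion _ fun q _ => hbadmeas _ _ _
  · have hsub : Set.Ioo ζ₁ ζ₂ \ (Set.Ioo ζ₁ ζ₂ \ ⋃ N : ℕ, badN (N+1)) ⊆ ⋃ N : ℕ, badN (N+1) := by
      intro x hx
      by_contra h
      exact hx.2 ⟨hx.1, h⟩
    have hγr : 0 < γ^(1/(r:ℝ)) := by positivity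
    calc _ ≤ _ := MeasureTheory.measure_mono hsub
      _ ≤ _ := MeasureTheory.measure_iUnion_le _
      _ ≤ ∑' N : ℕ, ENNReal.ofReal (D * γ^(1/(r:ℝ)) * (1 / ((N:ℝ)+1)^2)) := by
        refine ENNReal.tsum_le_tsum fun N => ?_
        have := hbadN (N+1) (by omega)
        push_cast at this
        exact this
      _ = ENNReal.ofReal (∑' N : ℕ, D * γ^(1/(r:ℝ)) * (1 / ((N:ℝ)+1)^2)) :=
        (ENNReal.ofReal_tsum_of_nonneg (fun N => by positivity) (hsummable.mul_left _)).symm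
      _ ≤ _ := by
        apply ENNReal.ofReal_le_ofReal
        rw [tsum_mul_left]
        nlinarith
  · intro ζ hζ N hN j σ hσ hj hne
    rw [beam_eq] at hne ⊢
    rw [Real.rpow_natCast]
    by_contra hcon
    push Not at hcon
    apply hζ.2
    rw [Set.mem_iUnion]
    refine ⟨N-1, ?_⟩
    rw [Nat.sub_add_cancel hN]
    simp only [badN, Set.mem_iUnion]
    refine ⟨(j, σ), ?_, hζ.1, hne, hcon⟩
    rw [Finset.mem_filter, Finset.mem_product]
    refine ⟨⟨?_, ?_⟩, hj⟩
    · refine Fintype.mem_piFinset.mpr fun l => Fintype.mem_piFinset.mpr fun i => ?_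
      have := entry_le (j l) N (hj l) i
      have h2 : |j l i| ≤ (N:ℤ) := by exact_mod_cast this
      rw [Finset.mem_Icc]
      exact abs_le.mp h2
    · refine Fintype.mem_piFinset.mpr fun l => ?_
      simpa using hσ l

end AG
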